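/- The function λ ↦ S_k(λ)^{1/k} is concave on the cone Γ_k, i.e., for all λ, μ ∈ Γ_k and t ∈ [0,1], S_k(tλ + (1-t)μ)^{1/k} ≥ t·S_k(λ)^{1/k} + (1-t)·S_k(μ)^{1/k}. -/

import Mathlib

open scoped BigOperators
noncomputable section

/-- The `k`-th elementary symmetric function of `lam` over an index set `s`. -/
def esymmOn {n : ℕ} (s : Finset (Fin n)) (k : ℕ) (lam : Fin n → ℝ) : ℝ :=
  ∑ t ∈ s.powersetCard k, ∏ i ∈ t, lam i

/-- The `k`-th elementary symmetric polynomial `S_k` on `ℝ^n`. -/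
def esymm' (n k : ℕ) (lam : Fin n → ℝ) : ℝ := esymmOn Finset.univ k lam

/-- The Gårding cone `Γ_k = {λ : S_i(λ) > 0, 1 ≤ i ≤ k}`. -/
def Gamma (n k : ℕ) : Set (Fin n → ℝ) :=
  {lam | ∀ i : ℕ, 1 ≤ i → i ≤ k → 0 < esymm' n i lam}

open Polynomial in
lemma splits_deriv (p : ℝ[X]) (hp : p.Splits) : (derivative p).Splits := by
  by_cases h0 : p.natDegree = 0
  · apply Splits.of_natDegree_eq_zero
    have := natDegree_derivative_le p
    omega
  · rw [splits_iff_card_roots] at hp ⊢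
    have h1 := card_roots_le_derivative p
    have h2 := card_roots' (derivative p)
    have h3 := natDegree_derivative_le p
    omega

open Polynomial in
lemma laguerre (p : ℝ[X]) (hp : p.Splits) (t : ℝ) :
    p.eval t * (derivative (derivative p)).eval t ≤ (derivative p).eval t ^ 2 := by
  obtain ⟨m, hm⟩ := splits_iff_exists_multiset.1 hp
  have key : ∀ m : Multiset ℝ, (m.map (fun a => X - C a)).prod.eval t *
      (derivative (derivative (m.map (fun a => X - C a)).prod)).eval t ≤
      (derivative (m.map (fun a => X - C a)).prod).eval t ^ 2 := by
    intro m
    induction m using Multiset.induction_on with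
    | empty => simp
    | cons a m ih =>
      simp only [Multiset.map_cons, Multiset.prod_cons, derivative_mul, derivative_add,
        derivative_sub, derivative_X, derivative_C, eval_add, eval_mul, eval_sub, eval_X, eval_C,
        sub_zero, one_mul]
      generalize eval t (m.map (fun a => X - C a)).prod = A at *
      generalize eval t (derivative (m.map (fun a => X - C a)).prod) = B at *
      generalize eval t (derivative (derivative (m.map (fun a => X - C a)).prod)) = D at *
      nlinarith [mul_nonneg (sq_nonneg (t - a)) (sub_nonneg.2 ih), sq_nonneg A]
  have := key m
  rw [hm]
  simp only [derivative_mul, derivative_C, zero_mul, zero_add, eval_mul, eval_C, mul_pow]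
  nlinarith [mul_le_mul_of_nonneg_left this (sq_nonneg p.leadingCoeff)]

open Polynomial in
lemma newton_coeff (p : ℝ[X]) (hp : p.Splits) (k : ℕ) :
    p.coeff k * p.coeff (k + 2) ≤ p.coeff (k + 1) ^ 2 := by
  have hs : ∀ k, (derivative^[k] p).Splits := by
    intro k
    induction k with
    | zero => simpa
    | succ k ih => rw [Function.iterate_succ_apply']; exact splits_deriv _ ih
  have h := laguerre _ (hs k) 0
  rw [← Function.iterate_succ_apply' derivative, ← Function.iterate_succ_apply' derivative,
    ← coeff_zero_eq_eval_zero, ← coeff_zero_eq_eval_zero, ← coeff_zero_eq_eval_zero,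
    coeff_iterate_derivative, coeff_iterate_derivative, coeff_iterate_derivative] at h
  simp only [zero_add, Nat.succ_eq_add_one, Nat.descFactorial_self, nsmul_eq_mul,
    Nat.factorial_succ, Nat.cast_mul, add_assoc, Nat.reduceAdd] at h
  push_cast at h
  have hf : (0 : ℝ) < (k.factorial : ℝ) := by positivity
  have h2 : ((k : ℝ) + 2) * (p.coeff k * p.coeff (k + 2)) ≤ ((k : ℝ) + 1) * p.coeff (k + 1) ^ 2 := by
    have hc : (0 : ℝ) < (k.factorial : ℝ) ^ 2 * (k + 1) := by positivity
    refine le_of_mul_le_mul_left ?_ hc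
    nlinarith [h]
  have hk : (0 : ℝ) ≤ k := by positivity
  by_cases hn : p.coeff k * p.coeff (k + 2) ≤ 0
  · nlinarith [sq_nonneg (p.coeff (k + 1))]
  · push Not at hn
    nlinarith

section helpers

variable {n : ℕ}

lemma e_zero (s : Finset (Fin n)) (x : Fin n → ℝ) : esymmOn s 0 x = 1 := by
  simp [esymmOn]

lemma e_empty (k : ℕ) (x : Fin n → ℝ) : esymmOn ∅ (k + 1) x = 0 := by
  unfold esymmOn
  rw [Finset.powersetCard_eq_empty.2 (by simp), Finset.sum_empty]

lemma e_insert (s : Finset (Fin n)) (a : Fin n) (ha : a ∉ s) (k : ℕ) (x : Fin n → ℝ) :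
    esymmOn (insert a s) (k + 1) x = x a * esymmOn s k x + esymmOn s (k + 1) x := by
  unfold esymmOn
  have hm : ∀ m, ∀ t ∈ s.powersetCard m, a ∉ t := fun m t ht h =>
    ha ((Finset.mem_powersetCard.1 ht).1 h)
  rw [← Nat.succ_eq_add_one, Finset.powersetCard_succ_insert ha, Finset.sum_union, add_comm,
    Finset.sum_image]
  · congr 1
    rw [Finset.mul_sum]
    refine Finset.sum_congr rfl fun t ht => ?_
    rw [Finset.prod_insert (hm _ t ht)]
  · intro t ht u hu h
    rw [← Finset.erase_insert (hm _ t ht), ← Finset.erase_insert (hm _ u hu)]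
    exact congrArg (fun v => v.erase a) h
  · rw [Finset.disjoint_left]
    intro t ht h
    obtain ⟨u, _, rfl⟩ := Finset.mem_image.1 h
    exact hm _ _ ht (Finset.mem_insert_self _ _)

lemma e_erase (s : Finset (Fin n)) (a : Fin n) (ha : a ∈ s) (k : ℕ) (x : Fin n → ℝ) :
    esymmOn s (k + 1) x = x a * esymmOn (s.erase a) k x + esymmOn (s.erase a) (k + 1) x := by
  rw [← e_insert _ _ (Finset.notMem_erase a s), Finset.insert_erase ha]

lemma e_euler (x : Fin n → ℝ) (s : Finset (Fin n)) (k : ℕ) :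
    ((k : ℝ) + 1) * esymmOn s (k + 1) x = ∑ i ∈ s, x i * esymmOn (s.erase i) k x := by
  induction s using Finset.induction_on generalizing k with
  | empty => simp [e_empty]
  | insert a s ha ih =>
    rw [Finset.sum_insert ha, Finset.erase_insert ha, e_insert _ _ ha]
    have hne : ∀ i ∈ s, (insert a s).erase i = insert a (s.erase i) := fun i hi =>
      Finset.erase_insert_of_ne (fun h => ha (h ▸ hi))
    cases k with
    | zero =>
      have := ih 0
      simp only [e_zero] at this ⊢
      push_cast at this ⊢
      linarith
    | succ k =>
      have : ∑ i ∈ s, x i * esymmOn ((insert a s).erase i) (k + 1) x =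
          x a * ∑ i ∈ s, x i * esymmOn (s.erase i) k x
            + ∑ i ∈ s, x i * esymmOn (s.erase i) (k + 1) x := by
        rw [Finset.mul_sum, ← Finset.sum_add_distrib]
        refine Finset.sum_congr rfl fun i hi => ?_
        rw [hne i hi, e_insert _ _ (fun h => ha (Finset.mem_of_mem_erase h))]
        ring
      rw [this, ← ih, ← ih]
      push_cast
      ring

open Polynomial in
lemma e_coeff (x : Fin n → ℝ) (s : Finset (Fin n)) (k : ℕ) :
    (∏ i ∈ s, (C (x i) * X + C 1)).coeff k = esymmOn s k x := by
  induction s using Finset.induction_on generalizing k with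
  | empty =>
    cases k with
    | zero => simp [e_zero]
    | succ k => simp [e_empty, coeff_one]
  | insert a s ha ih =>
    rw [Finset.prod_insert ha, add_mul, coeff_add, mul_assoc, coeff_C_mul, C_1, one_mul]
    cases k with
    | zero => simp only [C_1] at ih; simp [e_zero, ih]
    | succ k => simp only [C_1] at ih; rw [coeff_X_mul, ih, ih, e_insert _ _ ha]

open Polynomial in
lemma e_newton (x : Fin n → ℝ) (s : Finset (Fin n)) (k : ℕ) :
    esymmOn s k x * esymmOn s (k + 2) x ≤ esymmOn s (k + 1) x ^ 2 := by
  simp only [← e_coeff]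
  apply newton_coeff
  apply Splits.prod
  intro i _
  exact Splits.of_natDegree_le_one natDegree_linear_le

def GG (s : Finset (Fin n)) (k : ℕ) (x : Fin n → ℝ) : Prop := ∀ i ≤ k, 0 < esymmOn s i x

lemma GG_erase (s : Finset (Fin n)) (k : ℕ) (x : Fin n → ℝ) (h : GG s (k + 1) x) (a : Fin n)
    (ha : a ∈ s) : GG (s.erase a) k x := by
  intro j
  induction j with
  | zero => intro _; simp [e_zero]
  | succ j ih =>
    intro hj
    have h0 := ih (by omega)
    have h1 := h (j + 1) (by omega)
    have h2 := h (j + 2) (by omega)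
    have hN := e_newton x (s.erase a) j
    rw [e_erase s a ha] at h1 h2
    by_contra! hc
    generalize esymmOn (s.erase a) j x = A at *
    generalize esymmOn (s.erase a) (j + 1) x = B at *
    generalize esymmOn (s.erase a) (j + 2) x = D at *
    have h3 : A * (x a * B + D) > 0 := mul_pos h0 h2
    have h4 : B * (x a * A + B) ≤ 0 := mul_nonpos_of_nonpos_of_nonneg hc h1.le
    nlinarith

lemma scalar_ineq (a b q r w : ℝ) (hq : 0 < a + q) (hr : 0 < b + r) (hw : q + r ≤ w) :
    a * q / (a + q) + b * r / (b + r) ≤ (a + b) * w / (a + b + w) := by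
  have hz : 0 < a + b + w := by linarith
  have e1 : a * q / (a + q) = a - a ^ 2 / (a + q) := by field_simp; ring
  have e2 : b * r / (b + r) = b - b ^ 2 / (b + r) := by field_simp; ring
  have e3 : (a + b) * w / (a + b + w) = (a + b) - (a + b) ^ 2 / (a + b + w) := by
    field_simp; ring
  have h1 : (a + b) ^ 2 / ((a + q) + (b + r)) ≤ a ^ 2 / (a + q) + b ^ 2 / (b + r) := by
    rw [div_add_div _ _ hq.ne' hr.ne', div_le_div_iff₀ (by linarith) (by positivity)]
    nlinarith [sq_nonneg (a * (b + r) - b * (a + q))]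
  have h2 : (a + b) ^ 2 / (a + b + w) ≤ (a + b) ^ 2 / ((a + q) + (b + r)) :=
    div_le_div_of_nonneg_left (sq_nonneg _) (by linarith) (by linarith)
  linarith

lemma main_ind (k : ℕ) : ∀ (s : Finset (Fin n)) (x y : Fin n → ℝ), GG s (k + 1) x →
    GG s (k + 1) y → GG s (k + 1) (x + y) ∧
    esymmOn s (k + 1) x / esymmOn s k x + esymmOn s (k + 1) y / esymmOn s k y ≤
      esymmOn s (k + 1) (x + y) / esymmOn s k (x + y) := by
  induction k with
  | zero =>
    intro s x y hx hy
    have h1 : esymmOn s 1 (x + y) = esymmOn s 1 x + esymmOn s 1 y := by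
      have a := e_euler x s 0
      have b := e_euler y s 0
      have c := e_euler (x + y) s 0
      simp [e_zero, Finset.sum_add_distrib] at a b c
      linarith
    refine ⟨?_, by simp [e_zero, h1]⟩
    intro i hi
    interval_cases i
    · simp [e_zero]
    · rw [h1]; exact add_pos (hx 1 le_rfl) (hy 1 le_rfl)
  | succ k ih =>
    intro s x y hx hy
    have hG := (ih s x y (fun i hi => hx i (by omega)) (fun i hi => hy i (by omega))).1
    have hx1 := hx (k + 1) (by omega)
    have hy1 := hy (k + 1) (by omega)
    have hz1 := hG (k + 1) le_rfl
    have rep : ∀ z : Fin n → ℝ, esymmOn s (k + 1 + 1) z / esymmOn s (k + 1) z =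
        (∑ i ∈ s, z i * esymmOn (s.erase i) (k + 1) z / esymmOn s (k + 1) z) / ((k : ℝ) + 2) := by
      intro z
      have := e_euler z s (k + 1)
      rw [← Finset.sum_div, ← this]
      have : (k : ℝ) + 2 ≠ 0 := by positivity
      push_cast
      field_simp
      ring
    have hq : esymmOn s (k + 1 + 1) x / esymmOn s (k + 1) x +
        esymmOn s (k + 1 + 1) y / esymmOn s (k + 1) y ≤
        esymmOn s (k + 1 + 1) (x + y) / esymmOn s (k + 1) (x + y) := by
      rw [rep, rep, rep, ← add_div, ← Finset.sum_add_distrib]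
      refine div_le_div_of_nonneg_right ?_ (by positivity)
      refine Finset.sum_le_sum fun i hi => ?_
      have gx := GG_erase s (k + 1) x hx i hi
      have gy := GG_erase s (k + 1) y hy i hi
      obtain ⟨gz, hle⟩ := ih _ x y gx gy
      have tm : ∀ z : Fin n → ℝ, GG (s.erase i) (k + 1) z → 0 < esymmOn s (k + 1) z →
          0 < z i + esymmOn (s.erase i) (k + 1) z / esymmOn (s.erase i) k z ∧
          z i * esymmOn (s.erase i) (k + 1) z / esymmOn s (k + 1) z =
          z i * (esymmOn (s.erase i) (k + 1) z / esymmOn (s.erase i) k z) /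
          (z i + esymmOn (s.erase i) (k + 1) z / esymmOn (s.erase i) k z) := by
        intro z gz hz
        have p0 := gz k (by omega)
        have he : esymmOn s (k + 1) z / esymmOn (s.erase i) k z =
            z i + esymmOn (s.erase i) (k + 1) z / esymmOn (s.erase i) k z := by
          rw [e_erase s i hi]; field_simp
        rw [← he]
        refine ⟨div_pos hz p0, ?_⟩
        field_simp
      obtain ⟨px, ex⟩ := tm x gx hx1
      obtain ⟨py, ey⟩ := tm y gy hy1
      obtain ⟨pz, ez⟩ := tm (x + y) gz hz1
      rw [ex, ey, ez]
      exact scalar_ineq _ _ _ _ _ px py hle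
    refine ⟨?_, hq⟩
    intro i hi
    rcases Nat.lt_or_ge i (k + 1 + 1) with h | h
    · exact hG i (by omega)
    · obtain rfl : i = k + 1 + 1 := by omega
      have a := div_pos (hx _ hi) hx1
      have b := div_pos (hy _ hi) hy1
      have c : 0 < esymmOn s (k + 1 + 1) (x + y) / esymmOn s (k + 1) (x + y) := by linarith
      exact (div_pos_iff_of_pos_right hz1).1 c

lemma superadd (s : Finset (Fin n)) (k : ℕ) (hk : 1 ≤ k) (x y : Fin n → ℝ) (hx : GG s k x)
    (hy : GG s k y) : esymmOn s k x ^ ((1 : ℝ) / k) + esymmOn s k y ^ ((1 : ℝ) / k) ≤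
      esymmOn s k (x + y) ^ ((1 : ℝ) / k) := by
  have hz : GG s k (x + y) := by
    obtain ⟨m, rfl⟩ : ∃ m, k = m + 1 := ⟨k - 1, by omega⟩
    exact (main_ind m s x y hx hy).1
  have hk0 : (0 : ℝ) < k := by exact_mod_cast hk
  let q : (Fin n → ℝ) → ℕ → ℝ := fun z i => esymmOn s (i + 1) z / esymmOn s i z
  have qpos : ∀ z, GG s k z → ∀ i ∈ Finset.range k, 0 < q z i := by
    intro z hz i hi
    have := Finset.mem_range.1 hi
    exact div_pos (hz _ (by omega)) (hz _ (by omega))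
  have tele : ∀ z, GG s k z → ∀ j ≤ k, ∏ i ∈ Finset.range j, q z i = esymmOn s j z := by
    intro z hz j
    induction j with
    | zero => intro _; simp [e_zero]
    | succ j ih =>
      intro hj
      rw [Finset.prod_range_succ, ih (by omega)]
      exact mul_div_cancel₀ _ (hz j (by omega)).ne'
  have amgm : ∀ z, GG s k z → (esymmOn s k z / esymmOn s k (x + y)) ^ ((1 : ℝ) / k) ≤
      ∑ i ∈ Finset.range k, (1 : ℝ) / k * (q z i / q (x + y) i) := by
    intro z hz'
    have hp : ∀ i ∈ Finset.range k, 0 ≤ q z i / q (x + y) i := fun i hi =>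
      (div_pos (qpos z hz' i hi) (qpos _ hz i hi)).le
    have := Real.geom_mean_le_arith_mean_weighted (Finset.range k) (fun _ => (1 : ℝ) / k)
      (fun i => q z i / q (x + y) i) (fun _ _ => by positivity)
      (by simp; field_simp) hp
    rw [Real.finsetProd_rpow _ _ hp, Finset.prod_div_distrib, tele z hz' k le_rfl,
      tele _ hz k le_rfl] at this
    exact this
  have hsum : (esymmOn s k x / esymmOn s k (x + y)) ^ ((1 : ℝ) / k) +
      (esymmOn s k y / esymmOn s k (x + y)) ^ ((1 : ℝ) / k) ≤ 1 := by
    refine (add_le_add (amgm x hx) (amgm y hy)).trans ?_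
    rw [← Finset.sum_add_distrib]
    have : ∑ i ∈ Finset.range k, (1 : ℝ) / k = 1 := by simp; field_simp
    refine le_trans ?_ this.le
    refine Finset.sum_le_sum fun i hi => ?_
    have hi' := Finset.mem_range.1 hi
    have h := (main_ind i s x y (fun j hj => hx j (by omega)) (fun j hj => hy j (by omega))).2
    have hqz := qpos _ hz i hi
    have h' : q x i / q (x + y) i + q y i / q (x + y) i ≤ 1 := by
      rw [← add_div, div_le_one hqz]; exact h
    have : (0 : ℝ) ≤ 1 / k := by positivity
    nlinarith
  have pz := hz k le_rfl
  rw [Real.div_rpow (hx k le_rfl).le pz.le, Real.div_rpow (hy k le_rfl).le pz.le, ← add_div,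
    div_le_one (Real.rpow_pos_of_pos pz _)] at hsum
  exact hsum

lemma e_smul (s : Finset (Fin n)) (k : ℕ) (t : ℝ) (x : Fin n → ℝ) :
    esymmOn s k (fun i => t * x i) = t ^ k * esymmOn s k x := by
  unfold esymmOn
  rw [Finset.mul_sum]
  refine Finset.sum_congr rfl fun u hu => ?_
  rw [Finset.prod_mul_distrib, Finset.prod_const, (Finset.mem_powersetCard.1 hu).2]

lemma GG_smul (s : Finset (Fin n)) (k : ℕ) (t : ℝ) (ht : 0 < t) (x : Fin n → ℝ)
    (h : GG s k x) : GG s k (fun i => t * x i) := by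
  intro i hi
  rw [e_smul]
  exact mul_pos (pow_pos ht i) (h i hi)

lemma GG_of (k : ℕ) (x : Fin n → ℝ) (h : x ∈ Gamma n k) : GG Finset.univ k x := by
  intro i hi
  rcases Nat.eq_zero_or_pos i with rfl | h0
  · simp [e_zero]
  · exact h i h0 hi

end helpers

/-- `S_k^{1/k}` is concave on `Γ_k`. -/
theorem stmt_3 (n k : ℕ) (hk : 1 ≤ k) (hkn : k ≤ n)
    (lam mu : Fin n → ℝ) (hlam : lam ∈ Gamma n k) (hmu : mu ∈ Gamma n k)
    (t : ℝ) (ht0 : 0 ≤ t) (ht1 : t ≤ 1) :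
    t * esymm' n k lam ^ ((1 : ℝ) / k) + (1 - t) * esymm' n k mu ^ ((1 : ℝ) / k)
      ≤ esymm' n k (fun i => t * lam i + (1 - t) * mu i) ^ ((1 : ℝ) / k) := by
  rcases ht0.eq_or_lt with rfl | h0
  · simp
  rcases ht1.eq_or_lt with rfl | h1
  · simp
  have h1' : 0 < 1 - t := by linarith
  have gl := GG_of k lam hlam
  have gm := GG_of k mu hmu
  have key := superadd Finset.univ k hk _ _ (GG_smul _ k t h0 lam gl) (GG_smul _ k (1 - t) h1' mu gm)
  have hs : ∀ c : ℝ, 0 < c → ∀ x : Fin n → ℝ, GG Finset.univ k x →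
      esymmOn Finset.univ k (fun i => c * x i) ^ ((1 : ℝ) / k) =
      c * esymmOn Finset.univ k x ^ ((1 : ℝ) / k) := by
    intro c hc x hx
    rw [e_smul, Real.mul_rpow (by positivity) (hx k le_rfl).le, one_div,
      Real.pow_rpow_inv_natCast hc.le (by omega)]
  rw [hs t h0 lam gl, hs (1 - t) h1' mu gm] at key
  exact key
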